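/- (Uniqueness of the Gandy–Hyland functional on continuous arguments.) Let Y : (ℕ → ℕ) → ℕ be pointwise continuous and let γ₁, γ₂ : List ℕ → ℕ both satisfy the Gandy–Hyland equation for Y. Then γ₁(s) = γ₂(s) for every finite sequence s of natural numbers. -/

import Mathlib

/-- `app s h` is the infinite sequence obtained by extending the finite sequence `s`
with the values of `h`, i.e. `s ⌢ h`.  In particular `app (s ++ [0]) h` is `s⌢⟨0⟩⌢h`
and `app s (fun _ => 0)` is `s⌢0^ω`. -/
def app (s : List ℕ) (h : ℕ → ℕ) : ℕ → ℕ := fun n =>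
  if hn : n < s.length then s[n] else h (n - s.length)

/-- `Y` is pointwise continuous on Baire space. -/
def PtwiseCont (Y : (ℕ → ℕ) → ℕ) : Prop :=
  ∀ f : ℕ → ℕ, ∃ N : ℕ, ∀ g : ℕ → ℕ, (∀ i < N, f i = g i) → Y f = Y g

/-- The canonical approximation `G(Y, s, M)` of the Gandy–Hyland functional:
`G(Y,s,M) = Y(s⌢0^ω)` if `|s| ≥ M`, and
`G(Y,s,M) = Y(s⌢⟨0⟩⌢(λ n. G(Y, s⌢⟨n+1⟩, M)))` otherwise. -/
def G (Y : (ℕ → ℕ) → ℕ) (s : List ℕ) (M : ℕ) : ℕ :=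
  if h : M ≤ s.length then Y (app s fun _ => 0)
  else Y (app (s ++ [0]) fun n => G Y (s ++ [n + 1]) M)
termination_by M - s.length
decreasing_by
  simp only [List.length_append, List.length_cons, List.length_nil]
  omega

/-- `γ` satisfies the Gandy–Hyland equation for `Y`. -/
def GHEq (Y : (ℕ → ℕ) → ℕ) (γ : List ℕ → ℕ) : Prop :=
  ∀ s : List ℕ, γ s = Y (app (s ++ [0]) fun n => γ (s ++ [n + 1]))

/-- Bar induction, in contrapositive form: a property of finite sequences that can always be
propagated to a one-step extension holds along arbitrarily long initial segments of some
infinite sequence. -/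
theorem exists_path_of_forall_extend {α : Type*} (P : List α → Prop)
    (hP : ∀ t, P t → ∃ a, P (t ++ [a])) (s : List α) (hs : P s) :
    ∃ f : ℕ → α, ∀ N, ∃ t : List α, N ≤ t.length ∧ P t ∧ ∀ i (hi : i < t.length), f i = t[i] := by
  choose next hnext using hP
  let S : ℕ → {t : List α // P t} := fun k =>
    Nat.rec ⟨s, hs⟩ (fun _ t => ⟨t.1 ++ [next t.1 t.2], hnext t.1 t.2⟩) k
  have hsucc : ∀ k, (S (k + 1)).1 = (S k).1 ++ [next (S k).1 (S k).2] := fun _ => rfl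
  have hlen : ∀ k, k ≤ (S k).1.length := by
    intro k
    induction k with
    | zero => exact Nat.zero_le _
    | succ k ih => simp [hsucc, ih]
  have hmono : ∀ {j k}, j ≤ k → (S j).1 <+: (S k).1 := by
    intro j k hjk
    induction hjk with
    | refl => exact List.prefix_rfl
    | step _ ih => exact ih.trans (by rw [Nat.succ_eq_add_one, hsucc]; exact List.prefix_append _ _)
  refine ⟨fun n => (S (n + 1)).1[n]'(hlen (n + 1)), fun N => ⟨(S N).1, hlen N, (S N).2, ?_⟩⟩
  intro i hi
  rcases le_total (i + 1) N with h | h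
  · exact (hmono h).getElem _
  · exact ((hmono h).getElem hi).symm

/-- Sequences extending a finite sequence `t` agree with `t` on its indices. -/
theorem app_append_of_lt (t u : List ℕ) (h : ℕ → ℕ) {i : ℕ} (hi : i < t.length) :
    app (t ++ u) h i = t[i] := by
  have hi' : i < (t ++ u).length := by simp only [List.length_append]; omega
  rw [app, dif_pos hi', List.getElem_append_left hi]

theorem gandy_hyland_unique (Y : (ℕ → ℕ) → ℕ) (hY : PtwiseCont Y)
    (γ₁ γ₂ : List ℕ → ℕ) (hγ₁ : GHEq Y γ₁) (hγ₂ : GHEq Y γ₂) (s : List ℕ) :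
    γ₁ s = γ₂ s := by
  by_contra hs
  obtain ⟨f, hf⟩ := exists_path_of_forall_extend (fun t => γ₁ t ≠ γ₂ t) (by
    intro t ht
    by_contra! h
    refine ht ?_
    rw [hγ₁ t, hγ₂ t]
    simp only [h]) s hs
  obtain ⟨N, hN⟩ := hY f
  obtain ⟨t, hNt, ht, hft⟩ := hf N
  have key : ∀ h, Y f = Y (app (t ++ [0]) h) := fun h => hN _ fun i hi => by
    rw [hft i (hi.trans_le hNt), app_append_of_lt t [0] h (hi.trans_le hNt)]
  exact ht (by rw [hγ₁ t, hγ₂ t, ← key, ← key])
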